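/- Let (a_n)_{n≥0} be a sequence of real numbers that is positive (a_n > 0 for all n), non-increasing, with limit 0, and asymptotically convex: there exists n₀ ≥ 1 such that 2a_n ≤ a_{n−1} + a_{n+1} for all n ≥ n₀. Then there exist N₀ ∈ ℕ and a sequence (ã_n)_{n≥0} with ã_0 = a_0 and ã_{N₀+k} = a_{N₀+k} for every k ≥ 0, such that: (1) ã_n ≥ 0 for every n ≥ 0; (2) (ã_n) is strictly decreasing; (3) (ã_n) is convex, i.e. 2ã_n ≤ ã_{n−1} + ã_{n+1} for all n ≥ 1. -/

import Mathlib

open Filter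

/-- A positive null sequence that is non-increasing and convex from index `m` on is
strictly decreasing from index `m` on. -/
theorem succ_lt_of_convex_of_tendsto_zero {a : ℕ → ℝ} {m : ℕ} (hpos : ∀ n, 0 < a n)
    (hmono : ∀ n, a (n + 1) ≤ a n) (hlim : Tendsto a atTop (nhds 0))
    (hdiff : ∀ n, m ≤ n → a (n + 1) - a (n + 2) ≤ a n - a (n + 1)) {n : ℕ} (hn : m ≤ n) :
    a (n + 1) < a n := by
  by_contra! h
  have hconst : ∀ k, a (n + k) = a n ∧ a (n + k + 1) = a n := by
    intro k
    induction k with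
    | zero => exact ⟨rfl, le_antisymm (hmono n) h⟩
    | succ k ih =>
      obtain ⟨h₀, h₁⟩ := ih
      have := hdiff (n + k) (by omega)
      have := hmono (n + k + 1)
      refine ⟨h₁, ?_⟩
      change a (n + k + 2) = a n
      change a (n + k + 2) ≤ _ at this
      linarith
  obtain ⟨N, hN⟩ := eventually_atTop.1 (hlim.eventually (gt_mem_nhds (hpos n)))
  have := hN (n + N) (by omega)
  rw [(hconst N).1] at this
  exact lt_irrefl _ this

/-- If the decrements of `a` are non-increasing from index `m` on, the total decrease between
`n` and `n + k` is at least `k` times the decrement at `n + k`. -/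
theorem mul_decrement_le {a : ℕ → ℝ} {m : ℕ}
    (hdiff : ∀ n, m ≤ n → a (n + 1) - a (n + 2) ≤ a n - a (n + 1)) {n : ℕ} (hn : m ≤ n) (k : ℕ) :
    k * (a (n + k) - a (n + k + 1)) ≤ a n - a (n + k) := by
  induction k with
  | zero => simp
  | succ k ih =>
    have h := hdiff (n + k) (by omega)
    have h' := mul_le_mul_of_nonneg_left h (by positivity : (0 : ℝ) ≤ k + 1)
    change ((k + 1 : ℕ) : ℝ) * (a (n + k + 1) - a (n + k + 2)) ≤ a n - a (n + k + 1)
    push_cast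
    linarith

/-- Proposition 4.3: a positive, non-increasing, null, asymptotically
convex sequence can be modified in finitely many places (keeping `a 0` and the tail)
into a nonnegative, strictly decreasing, convex sequence. -/
theorem stmt14 (a : ℕ → ℝ) (hpos : ∀ n, 0 < a n) (hmono : ∀ n, a (n + 1) ≤ a n)
    (hlim : Tendsto a atTop (nhds 0))
    (hconv : ∃ n₀ : ℕ, 1 ≤ n₀ ∧ ∀ n, n₀ ≤ n → 2 * a n ≤ a (n - 1) + a (n + 1)) :
    ∃ (N₀ : ℕ) (b : ℕ → ℝ), b 0 = a 0 ∧ (∀ k, b (N₀ + k) = a (N₀ + k)) ∧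
      (∀ n, 0 ≤ b n) ∧ StrictAnti b ∧
      (∀ n, 1 ≤ n → 2 * b n ≤ b (n - 1) + b (n + 1)) := by
  obtain ⟨m, -, hm⟩ := hconv
  have hdiff : ∀ n, m ≤ n → a (n + 1) - a (n + 2) ≤ a n - a (n + 1) := by
    intro n hn
    have h : 2 * a (n + 1) ≤ a n + a (n + 2) := hm (n + 1) (by omega)
    linarith
  have hlt : ∀ n, m ≤ n → a (n + 1) < a n := fun n hn =>
    succ_lt_of_convex_of_tendsto_zero hpos hmono hlim hdiff hn
  have hdlim : Tendsto (fun n => ((m : ℝ) + 1) * (a n - a (n + 1))) atTop (nhds 0) := by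
    simpa using (hlim.sub (hlim.comp (tendsto_add_atTop_nat 1))).const_mul ((m : ℝ) + 1)
  obtain ⟨K, hK⟩ := eventually_atTop.1
    (hdlim.eventually (gt_mem_nhds (sub_pos.2 (hlt m le_rfl))))
  obtain ⟨N, hN⟩ : ∃ N, N = m + 1 + K := ⟨_, rfl⟩
  have hNpos : (0 : ℝ) < N := by rw [hN]; positivity
  -- The slope of the chord from `(0, a 0)` to `(N, a N)` dominates the decrement at `N`.
  have hslope : a N - a (N + 1) ≤ (a 0 - a N) / N := by
    rw [le_div_iff₀ hNpos]
    have h₁ := hK N (by omega)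
    have h₂ := mul_decrement_le hdiff (Nat.le_succ m) K
    have h₃ : a m ≤ a 0 := antitone_nat_of_succ_le hmono (Nat.zero_le m)
    rw [Nat.succ_eq_add_one, ← hN] at h₂
    have hcast : (N : ℝ) = m + 1 + K := by rw [hN]; push_cast; ring
    rw [hcast]
    linarith
  obtain ⟨s, hs⟩ : ∃ s, s = (a 0 - a N) / N := ⟨_, rfl⟩
  rw [← hs] at hslope
  have hsN : a 0 - s * N = a N := by rw [hs]; field_simp; ring
  have hspos : 0 < s := by linarith [hlt N (by omega)]
  obtain ⟨b, hb⟩ : ∃ b : ℕ → ℝ, b = fun n => if n ≤ N then a 0 - s * n else a n := ⟨_, rfl⟩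
  have hle : ∀ n, n ≤ N → b n = a 0 - s * n := fun n hn => by simp [hb, hn]
  have hge : ∀ n, N ≤ n → b n = a n := by
    intro n hn
    rcases hn.eq_or_lt with rfl | hn
    · rw [hle _ le_rfl, hsN]
    · simp [hb, hn]
  have hanti : StrictAnti b := by
    refine strictAnti_nat_of_succ_lt fun n => ?_
    rcases lt_or_ge n N with hn | hn
    · rw [hle n hn.le, hle (n + 1) hn]
      push_cast
      linarith
    · rw [hge n hn, hge (n + 1) (by omega)]
      exact hlt n (by omega)
  refine ⟨N, b, by simp [hle 0 (Nat.zero_le N)], fun k => hge _ (Nat.le_add_right N k), ?_,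
    hanti, ?_⟩
  · intro n
    have h := hanti.antitone (Nat.le_add_right n N)
    rw [hge (n + N) (by omega)] at h
    exact (hpos _).le.trans h
  · intro n hn
    obtain ⟨n, rfl⟩ := Nat.exists_eq_add_of_le' hn
    change 2 * b (n + 1) ≤ b n + b (n + 2)
    rcases lt_trichotomy (n + 1) N with h | h | h
    · rw [hle n (by omega), hle (n + 1) h.le, hle (n + 2) h]
      push_cast
      linarith
    · have h' := hle n (by omega)
      have h₁ := hle (n + 1) h.le
      have h₂ := hge (n + 1) h.ge
      have h₃ : b (n + 2) = a (N + 1) := by rw [hge (n + 2) (by omega), ← h]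
      rw [← h] at hslope h₃
      push_cast at h₁
      linarith
    · rw [hge n (by omega), hge (n + 1) h.le, hge (n + 2) (by omega)]
      linarith [hdiff n (by omega)]
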